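/- Let χ₁, …, χ_k ∈ ℤ^r be linearly independent over ℚ (with 1 ≤ k ≤ r), let a₁, …, a_k ∈ ℂˣ, let Γ be the subgroup of ℤ^r generated by χ₁, …, χ_k, and let K = {t ∈ T : a_i · χ_i(t) = 1 for all i}. Then the quotient group Γ̄/Γ is finite, the number of connected components of K (in the subspace topology) equals the cardinality of Γ̄/Γ, and every connected component of K is a coset t·T_{Γ̄} of the subgroup T_{Γ̄}. (Proposition 3.1, second part.) -/

import Mathlib

/-- The character of the torus `T = (ℂˣ)^r` associated to `χ ∈ ℤ^r`:
`t ↦ ∏ⱼ tⱼ^{χⱼ}`. -/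
noncomputable def charMap {r : ℕ} (χ : Fin r → ℤ) (t : Fin r → ℂˣ) : ℂˣ :=
  ∏ j, (t j) ^ (χ j)

/-- For a subgroup `Γ ≤ ℤ^r`, the subgroup `T_Γ = {t ∈ T : χ(t) = 1 ∀ χ ∈ Γ}`. -/
def torusKer {r : ℕ} (Γ : AddSubgroup (Fin r → ℤ)) : Set (Fin r → ℂˣ) :=
  {t | ∀ χ ∈ Γ, charMap χ t = 1}

/-- The saturation `Γ̄ = {χ ∈ ℤ^r : mχ ∈ Γ for some m > 0}` of a subgroup `Γ ≤ ℤ^r`. -/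
def saturation {r : ℕ} (Γ : AddSubgroup (Fin r → ℤ)) : AddSubgroup (Fin r → ℤ) where
  carrier := {χ | ∃ m : ℤ, 0 < m ∧ m • χ ∈ Γ}
  zero_mem' := ⟨1, one_pos, by simpa using Γ.zero_mem⟩
  add_mem' := by
    rintro x y ⟨mx, hmx, hx⟩ ⟨my, hmy, hy⟩
    refine ⟨mx * my, mul_pos hmx hmy, ?_⟩
    have : (mx * my) • (x + y) = my • (mx • x) + mx • (my • y) := by
      rw [smul_add, smul_smul, smul_smul, mul_comm my mx]
    rw [this]
    exact Γ.add_mem (Γ.zsmul_mem hx my) (Γ.zsmul_mem hy mx)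
  neg_mem' := by
    rintro x ⟨m, hm, hx⟩
    exact ⟨m, hm, by simpa [smul_neg] using Γ.neg_mem hx⟩

open Module in
theorem aux_card_roots (m : ℤ) (hm : m ≠ 0) (c : ℂˣ) :
    Nat.card {x : ℂˣ // x ^ m = c} = m.natAbs := by
  obtain ⟨d, hd⟩ : ∃ d : ℂˣ, ∀ x : ℂˣ, x ^ m = c ↔ x ^ m.natAbs = d := by
    rcases Int.natAbs_eq m with h | h
    · refine ⟨c, fun x => ?_⟩
      conv_lhs => rw [h, zpow_natCast]
    · refine ⟨c⁻¹, fun x => ?_⟩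
      conv_lhs => rw [h, zpow_neg, zpow_natCast, inv_eq_iff_eq_inv]
  have hn : m.natAbs ≠ 0 := Int.natAbs_ne_zero.mpr hm
  generalize m.natAbs = n at hd hn
  obtain ⟨z, hz⟩ := IsAlgClosed.exists_pow_nat_eq (d : ℂ) (Nat.pos_of_ne_zero hn)
  have hz0 : z ≠ 0 := by
    rintro rfl
    rw [zero_pow hn] at hz
    exact d.ne_zero hz.symm
  have hu : (Units.mk0 z hz0) ^ n = d := by
    ext; simpa using hz
  have : NeZero n := ⟨hn⟩
  rw [← Complex.card_rootsOfUnity n]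
  refine Nat.card_congr
    { toFun := fun x => ⟨x.1 / Units.mk0 z hz0, ?_⟩
      invFun := fun x => ⟨x.1 * Units.mk0 z hz0, ?_⟩
      left_inv := fun x => by simp
      right_inv := fun x => by simp }
  · rw [mem_rootsOfUnity, div_pow, hu, (hd _).1 x.2, div_self']
  · rw [hd, mul_pow, hu, (mem_rootsOfUnity _ _).1 x.2, one_mul]

theorem aux_connected_units : IsPreconnected (Set.univ : Set ℂˣ) := by
  let e : ℂ → ℂˣ := fun z => ⟨Complex.exp z, Complex.exp (-z),
    by rw [← Complex.exp_add]; simp, by rw [← Complex.exp_add]; simp⟩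
  have he : Continuous e := by
    rw [Units.continuous_iff]
    refine ⟨Complex.continuous_exp, ?_⟩
    exact Complex.continuous_exp.comp continuous_neg
  have hs : Function.Surjective e := fun u =>
    ⟨Complex.log u, by ext; exact Complex.exp_log u.ne_zero⟩
  rw [← hs.range_eq]
  exact isPreconnected_range he

/-- evaluation at `t` as a linear map -/
noncomputable def chom {r : ℕ} (t : Fin r → ℂˣ) : (Fin r → ℤ) →ₗ[ℤ] Additive ℂˣ :=
  AddMonoidHom.toIntLinearMap
    { toFun := fun x => Additive.ofMul (charMap x t)
      map_zero' := by simp [charMap]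
      map_add' := fun x y => by
        rw [← ofMul_mul]
        simp [charMap, zpow_add, Finset.prod_mul_distrib] }

theorem chom_apply {r : ℕ} (t : Fin r → ℂˣ) (x : Fin r → ℤ) :
    chom t x = Additive.ofMul (charMap x t) := rfl

theorem charMap_mul {r : ℕ} (x : Fin r → ℤ) (s t : Fin r → ℂˣ) :
    charMap x (s * t) = charMap x s * charMap x t := by
  simp [charMap, mul_zpow, Finset.prod_mul_distrib]

theorem charMap_inv {r : ℕ} (x : Fin r → ℤ) (s : Fin r → ℂˣ) :
    charMap x (s⁻¹) = (charMap x s)⁻¹ := by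
  simp [charMap]

theorem charMap_single {r : ℕ} (j : Fin r) (t : Fin r → ℂˣ) :
    charMap (Pi.single j 1) t = t j := by
  rw [charMap, Finset.prod_eq_single j]
  · simp
  · intro b _ hb; simp [hb]
  · simp

theorem charMap_continuous {r : ℕ} (x : Fin r → ℤ) : Continuous (charMap x) := by
  unfold charMap
  exact continuous_finsetProd _ fun j _ => (continuous_apply j).zpow _

/-- coordinates to torus -/
noncomputable def toTorus {r : ℕ} (b : Module.Basis (Fin r) ℤ (Fin r → ℤ)) (u : Fin r → ℂˣ) :
    Fin r → ℂˣ := fun j => ∏ i, u i ^ (b.repr (Pi.single j 1) i)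

theorem chom_toTorus {r : ℕ} (b : Module.Basis (Fin r) ℤ (Fin r → ℤ)) (u : Fin r → ℂˣ) :
    chom (toTorus b u) = b.constr ℤ (fun i => Additive.ofMul (u i)) := by
  refine (Pi.basisFun ℤ (Fin r)).ext fun j => ?_
  rw [Pi.basisFun_apply, chom_apply, charMap_single,
    Module.Basis.constr_apply_fintype, toTorus, ofMul_prod]
  rfl

theorem charMap_toTorus {r : ℕ} (b : Module.Basis (Fin r) ℤ (Fin r → ℤ)) (u : Fin r → ℂˣ)
    (i : Fin r) : charMap (b i) (toTorus b u) = u i := by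
  have := congrArg (fun L => L (b i)) (chom_toTorus b u)
  simp only [Module.Basis.constr_basis] at this
  exact this

theorem toTorus_charMap {r : ℕ} (b : Module.Basis (Fin r) ℤ (Fin r → ℤ)) (t : Fin r → ℂˣ) :
    toTorus b (fun i => charMap (b i) t) = t := by
  have : chom (toTorus b (fun i => charMap (b i) t)) = chom t := by
    refine b.ext fun i => ?_
    rw [chom_apply, chom_apply, charMap_toTorus]
  funext j
  have h := congrArg (fun L => L (Pi.single j 1)) this
  simp only [chom_apply, charMap_single] at h
  exact h

theorem toTorus_continuous {r : ℕ} (b : Module.Basis (Fin r) ℤ (Fin r → ℤ)) :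
    Continuous (toTorus b) := by
  unfold toTorus
  exact continuous_pi fun j => continuous_finsetProd _ fun i _ => (continuous_apply i).zpow _

theorem aux_expand {r n : ℕ} (b : Module.Basis (Fin r) ℤ (Fin r → ℤ)) (f : Fin n ↪ Fin r)
    (x : Fin r → ℤ) (hx : ∀ j ∉ Set.range f, b.repr x j = 0) :
    x = ∑ i, b.repr x (f i) • b (f i) := by
  conv_lhs => rw [← b.sum_repr x]
  rw [← Finset.sum_map Finset.univ f (fun j => b.repr x j • b j)]
  symm
  refine Finset.sum_subset (Finset.subset_univ _) fun j _ hj => ?_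
  rw [hx j (by simpa using hj), zero_smul]

theorem aux_mem {r n : ℕ} (N : Submodule ℤ (Fin r → ℤ))
    (s : Module.Basis.SmithNormalForm N (Fin r) n) (x : Fin r → ℤ) :
    x ∈ N ↔ (∀ j ∉ Set.range s.f, s.bM.repr x j = 0) ∧ ∀ i, s.a i ∣ s.bM.repr x (s.f i) := by
  constructor
  · intro hx
    refine ⟨fun j hj => s.repr_eq_zero_of_notMem_range ⟨x, hx⟩ hj, fun i => ?_⟩
    have := s.repr_apply_embedding_eq_repr_smul ⟨x, hx⟩ (i := i)
    simp only at this
    rw [this, map_smul, Finsupp.smul_apply, smul_eq_mul]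
    exact dvd_mul_right _ _
  · rintro ⟨h1, h2⟩
    rw [aux_expand s.bM s.f x h1]
    refine N.sum_mem fun i _ => ?_
    obtain ⟨c, hc⟩ := h2 i
    rw [hc, mul_comm, mul_smul, ← s.snf]
    exact N.smul_mem _ (s.bN i).2

theorem aux_a_ne {r n : ℕ} (N : Submodule ℤ (Fin r → ℤ))
    (s : Module.Basis.SmithNormalForm N (Fin r) n) (i : Fin n) : s.a i ≠ 0 := by
  intro h
  have := s.snf i
  rw [h, zero_smul] at this
  exact s.bN.ne_zero i (Subtype.ext this)

theorem aux_mem_sat {r n : ℕ} (N : Submodule ℤ (Fin r → ℤ))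
    (s : Module.Basis.SmithNormalForm N (Fin r) n) (x : Fin r → ℤ) :
    x ∈ saturation N.toAddSubgroup ↔ ∀ j ∉ Set.range s.f, s.bM.repr x j = 0 := by
  constructor
  · rintro ⟨m, hm, hx⟩ j hj
    have := ((aux_mem N s _).1 hx).1 j hj
    rw [map_smul, Finsupp.smul_apply, smul_eq_mul] at this
    exact (mul_eq_zero.1 this).resolve_left hm.ne'
  · intro h
    have hne : ∏ i, s.a i ≠ 0 := Finset.prod_ne_zero_iff.2 fun i _ => aux_a_ne N s i
    refine ⟨|∏ i, s.a i|, abs_pos.2 hne, (aux_mem N s _).2 ⟨fun j hj => ?_, fun i => ?_⟩⟩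
    · rw [map_smul, Finsupp.smul_apply, h j hj, smul_zero]
    · rw [map_smul, Finsupp.smul_apply, smul_eq_mul]
      exact Dvd.dvd.mul_right ((dvd_abs _ _).2 (Finset.dvd_prod_of_mem _ (Finset.mem_univ i))) _

theorem aux_b_sat {r n : ℕ} (N : Submodule ℤ (Fin r → ℤ))
    (s : Module.Basis.SmithNormalForm N (Fin r) n) (i : Fin n) :
    s.bM (s.f i) ∈ saturation N.toAddSubgroup := by
  rw [aux_mem_sat N s]
  intro j hj
  rw [Module.Basis.repr_self, Finsupp.single_eq_of_ne]
  rintro rfl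
  exact hj ⟨i, rfl⟩

/-- the quotient -/
theorem aux_quot {r n : ℕ} (N : Submodule ℤ (Fin r → ℤ))
    (s : Module.Basis.SmithNormalForm N (Fin r) n) :
    Nonempty ((saturation N.toAddSubgroup) ⧸
      (N.toAddSubgroup.addSubgroupOf (saturation N.toAddSubgroup)) ≃
      (∀ i, ZMod (s.a i).natAbs)) := by
  let φ : saturation N.toAddSubgroup →+ (∀ i, ZMod (s.a i).natAbs) :=
    { toFun := fun x i => (s.bM.repr x.1 (s.f i) : ℤ)
      map_zero' := by ext; simp
      map_add' := fun x y => by ext; simp }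
  have hφ : ∀ x i, φ x i = ((s.bM.repr x.1 (s.f i) : ℤ) : ZMod (s.a i).natAbs) := fun _ _ => rfl
  have hsurj : Function.Surjective φ := by
    intro v
    choose w hw using fun i => ZMod.intCast_surjective (v i)
    refine ⟨⟨∑ i, w i • s.bM (s.f i), AddSubgroup.sum_mem _ fun i _ =>
      AddSubgroup.zsmul_mem _ (aux_b_sat N s i) _⟩, ?_⟩
    funext i
    rw [hφ, ← hw i]
    congr 1
    simp only [map_sum, map_smul, Finsupp.coe_finsetSum, Finset.sum_apply, Finsupp.smul_apply,
      Module.Basis.repr_self, Finsupp.single_apply, s.f.injective.eq_iff]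
    simp
  have hker : N.toAddSubgroup.addSubgroupOf (saturation N.toAddSubgroup) = φ.ker := by
    ext x
    rw [AddSubgroup.mem_addSubgroupOf, AddMonoidHom.mem_ker]
    change x.1 ∈ N ↔ _
    rw [aux_mem N s, funext_iff]
    simp only [hφ, Pi.zero_apply, ZMod.intCast_zmod_eq_zero_iff_dvd, Int.natAbs_dvd]
    exact ⟨fun h => h.2, fun h => ⟨(aux_mem_sat N s _).1 x.2, h⟩⟩
  rw [hker]
  exact ⟨(QuotientAddGroup.quotientKerEquivOfSurjective φ hsurj).toEquiv⟩

theorem aux_torusKer {r n : ℕ} (N : Submodule ℤ (Fin r → ℤ))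
    (s : Module.Basis.SmithNormalForm N (Fin r) n) (t : Fin r → ℂˣ) :
    t ∈ torusKer (saturation N.toAddSubgroup) ↔ ∀ i, charMap (s.bM (s.f i)) t = 1 := by
  constructor
  · exact fun h i => h _ (aux_b_sat N s i)
  · intro h x hx
    have h0 : chom t x = 0 := by
      rw [aux_expand s.bM s.f x ((aux_mem_sat N s x).1 hx), map_sum]
      refine Finset.sum_eq_zero fun i _ => ?_
      rw [map_smul, chom_apply, h i]
      simp
    exact h0

theorem aux_conn {r n : ℕ} (N : Submodule ℤ (Fin r → ℤ))
    (s : Module.Basis.SmithNormalForm N (Fin r) n) :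
    IsPreconnected (torusKer (saturation N.toAddSubgroup)) := by
  classical
  have h : torusKer (saturation N.toAddSubgroup) = toTorus s.bM ''
      (Set.pi Set.univ fun j => if j ∈ Set.range s.f then {(1 : ℂˣ)} else Set.univ) := by
    ext t
    rw [aux_torusKer N s]
    constructor
    · intro h
      refine ⟨fun i => charMap (s.bM i) t, fun j _ => ?_, toTorus_charMap _ _⟩
      dsimp only
      split_ifs with hj
      · obtain ⟨i, rfl⟩ := hj
        exact h i
      · trivial
    · rintro ⟨u, hu, rfl⟩ i
      rw [charMap_toTorus]
      have := hu (s.f i) trivial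
      simpa using this
  rw [h]
  refine IsPreconnected.image (isPreconnected_univ_pi fun j => ?_) _
    (toTorus_continuous _).continuousOn
  split_ifs
  · exact isPreconnected_singleton
  · exact aux_connected_units

theorem aux_main {r n : ℕ} (N : Submodule ℤ (Fin r → ℤ))
    (s : Module.Basis.SmithNormalForm N (Fin r) n) (c : Fin n → ℂˣ)
    (K : Set (Fin r → ℂˣ)) (hK : ∀ t, t ∈ K ↔ ∀ i, charMap (s.bM (s.f i)) t ^ s.a i = c i) :
    Nat.card (ConnectedComponents K) = ∏ i, (s.a i).natAbs ∧
    ∀ t ∈ K, connectedComponentIn K t =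
      (fun x => t * x) '' torusKer (saturation N.toAddSubgroup) := by
  let S := {v : Fin n → ℂˣ // ∀ i, v i ^ s.a i = c i}
  let e : S ≃ ∀ i, {x : ℂˣ // x ^ s.a i = c i} :=
    Equiv.subtypePiEquivPi (p := fun i (x : ℂˣ) => x ^ s.a i = c i)
  have hcard : Nat.card S = ∏ i, (s.a i).natAbs := by
    rw [Nat.card_congr e, Nat.card_pi]
    exact Finset.prod_congr rfl fun i _ => aux_card_roots _ (aux_a_ne N s i) _
  have hfin : Finite S := by
    refine Nat.finite_of_card_ne_zero ?_
    rw [hcard]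
    exact Finset.prod_ne_zero_iff.2 fun i _ => Int.natAbs_ne_zero.2 (aux_a_ne N s i)
  let p : K → S := fun t => ⟨fun i => charMap (s.bM (s.f i)) t.1, (hK _).1 t.2⟩
  have hp : Continuous p := Continuous.subtype_mk
    (continuous_pi fun i => (charMap_continuous _).comp continuous_subtype_val) _
  have hsub : ∀ t ∈ K, (fun x => t * x) '' torusKer (saturation N.toAddSubgroup) ⊆
      connectedComponentIn K t := by
    intro t ht
    refine IsPreconnected.subset_connectedComponentIn ?_ ?_ ?_
    · exact (aux_conn N s).image _ (continuous_const.mul continuous_id).continuousOn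
    · exact ⟨1, (aux_torusKer N s _).2 fun i => by simp [charMap], by simp⟩
    · rintro _ ⟨x, hx, rfl⟩
      rw [hK] at ht ⊢
      intro i
      rw [charMap_mul, (aux_torusKer N s _).1 hx i, mul_one, ht i]
  have hcoset : ∀ x y : K, p x = p y →
      y.1 ∈ (fun z => x.1 * z) '' torusKer (saturation N.toAddSubgroup) := by
    intro x y h
    refine ⟨x.1⁻¹ * y.1, (aux_torusKer N s _).2 fun i => ?_, by simp⟩
    have := congrFun (congrArg Subtype.val h) i
    simp only [p] at this
    rw [charMap_mul, charMap_inv, this, inv_mul_cancel]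
  constructor
  · rw [← hcard]
    refine Nat.card_congr (Equiv.ofBijective hp.connectedComponentsLift ⟨?_, ?_⟩)
    · intro x y
      obtain ⟨x, rfl⟩ := ConnectedComponents.surjective_coe x
      obtain ⟨y, rfl⟩ := ConnectedComponents.surjective_coe y
      intro h
      have h1 := hsub x.1 x.2 (hcoset x y h)
      rw [connectedComponentIn_eq_image x.2] at h1
      obtain ⟨z, hz, hzy⟩ := h1
      obtain rfl : z = y := Subtype.ext hzy
      exact ConnectedComponents.coe_eq_coe.2 (connectedComponent_eq hz)
    · rintro ⟨v, hv⟩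
      let u : Fin r → ℂˣ := Function.extend s.f v 1
      have hu : ∀ i, charMap (s.bM (s.f i)) (toTorus s.bM u) = v i := fun i => by
        rw [charMap_toTorus]
        exact s.f.injective.extend_apply _ _ _
      refine ⟨((⟨toTorus s.bM u, (hK _).2 fun i => by rw [hu, hv]⟩ : K) :
        ConnectedComponents K), ?_⟩
      exact Subtype.ext (funext hu)
  · intro t ht
    refine Set.Subset.antisymm ?_ (hsub t ht)
    intro y hy
    rw [connectedComponentIn_eq_image ht] at hy
    obtain ⟨z, hz, rfl⟩ := hy
    exact hcoset ⟨t, ht⟩ z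
      (hp.image_eq_of_connectedComponent_eq _ _ (connectedComponent_eq hz))

/-- **Proposition 3.1, second part.** With `χ₁,…,χ_k` linearly independent over `ℚ`,
`Γ = ⟨χ₁,…,χ_k⟩` and `K = {t : aᵢ·χᵢ(t) = 1 ∀ i}`: the quotient `Γ̄/Γ` is finite, the number
of connected components of `K` equals `|Γ̄/Γ|`, and every connected component of `K` is a
coset `t·T_{Γ̄}`. -/
theorem stmt1 {r k : ℕ} (hk1 : 1 ≤ k) (hkr : k ≤ r)
    (χ : Fin k → (Fin r → ℤ)) (a : Fin k → ℂˣ)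
    (hind : LinearIndependent ℚ (fun i => fun j => ((χ i j : ℚ))))
    (Γ : AddSubgroup (Fin r → ℤ)) (hΓ : Γ = AddSubgroup.closure (Set.range χ))
    (K : Set (Fin r → ℂˣ)) (hK : K = {t | ∀ i, a i * charMap (χ i) t = 1}) :
    Finite ((saturation Γ) ⧸ (Γ.addSubgroupOf (saturation Γ))) ∧
    Nat.card (ConnectedComponents K) =
      Nat.card ((saturation Γ) ⧸ (Γ.addSubgroupOf (saturation Γ))) ∧
    ∀ t ∈ K, connectedComponentIn K t = (fun s => t * s) '' torusKer (saturation Γ) := by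
  have hlin : LinearIndependent ℤ χ := by
    have h1 : LinearIndependent ℤ (fun i => fun j => ((χ i j : ℚ))) :=
      hind.restrict_scalars (fun x y h => by simpa using h)
    let g : (Fin r → ℤ) →ₗ[ℤ] (Fin r → ℚ) :=
      (Algebra.linearMap ℤ ℚ).compLeft (Fin r)
    exact LinearIndependent.of_comp g h1
  let N := Submodule.span ℤ (Set.range χ)
  have hN : Γ = N.toAddSubgroup := by
    rw [hΓ, ← Submodule.span_int_eq_addSubgroupClosure]
  obtain ⟨n, s⟩ := Submodule.smithNormalForm (Pi.basisFun ℤ (Fin r)) N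
  let bχ : Module.Basis (Fin k) ℤ N := Module.Basis.span hlin
  have hbχ : ∀ i, (bχ i : Fin r → ℤ) = χ i := fun i => by
    exact Module.Basis.coe_span_apply hlin i
  let φ : N →ₗ[ℤ] Additive ℂˣ := bχ.constr ℤ fun i => Additive.ofMul (a i)⁻¹
  have hφ : ∀ i, φ (bχ i) = Additive.ofMul (a i)⁻¹ := fun i => bχ.constr_basis ℤ _ i
  have hK2 : ∀ t, t ∈ K ↔ (chom t).comp N.subtype = φ := by
    intro t
    subst hK
    constructor
    · intro h
      refine bχ.ext fun i => ?_
      rw [hφ, LinearMap.comp_apply, Submodule.subtype_apply, hbχ, chom_apply,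
        eq_inv_of_mul_eq_one_right (h i)]
    · intro h i
      have h2 := congrArg (fun L => L (bχ i)) h
      simp only [hφ, LinearMap.comp_apply, Submodule.subtype_apply, hbχ, chom_apply] at h2
      rw [Additive.ofMul.injective h2, mul_inv_cancel]
  have hK3 : ∀ t, t ∈ K ↔ ∀ i, charMap (s.bM (s.f i)) t ^ s.a i = (φ (s.bN i)).toMul := by
    intro t
    have key : ∀ i, (chom t).comp N.subtype (s.bN i) =
        Additive.ofMul (charMap (s.bM (s.f i)) t ^ s.a i) := fun i => by
      rw [LinearMap.comp_apply, Submodule.subtype_apply, s.snf, map_smul, chom_apply, ofMul_zpow]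
    rw [hK2]
    constructor
    · intro h i
      rw [← h, key, toMul_ofMul]
    · intro h
      refine s.bN.ext fun i => ?_
      rw [key, h, ofMul_toMul]
  obtain ⟨e⟩ := aux_quot N s
  obtain ⟨h1, h2⟩ := aux_main N s _ K hK3
  rw [hN]
  have : ∀ i, NeZero (s.a i).natAbs := fun i => ⟨Int.natAbs_ne_zero.2 (aux_a_ne N s i)⟩
  refine ⟨Finite.of_equiv _ e.symm, ?_, h2⟩
  rw [h1, Nat.card_congr e, Nat.card_pi]
  exact Finset.prod_congr rfl fun i _ => (Nat.card_zmod _).symm
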